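/- For every s ∈ (0,1), lim_{n→∞} φ'_{n+1}(φ_{n+1}^{−1}(s)) / φ'_n(φ_n^{−1}(s)) = m. -/

import Mathlib

open MeasureTheory Filter Set

noncomputable section

/-- A configuration assigns to each Ulam–Harris label (a finite word on `ℕ`)
a number of children. A Galton–Watson tree is encoded by such a configuration. -/
abbrev Config : Type := List ℕ → ℕ

/-- `v` is a vertex of the tree encoded by the configuration `ω`:
every step of the path from the root is the index of a child of the previous vertex. -/
def memTree (ω : Config) (v : List ℕ) : Prop :=
  ∀ k, (h : k < v.length) → v.get ⟨k, h⟩ < ω (v.take k)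

/-- `Z ω u k` is the number of descendants of the vertex `u` at height `|u| + k`
in the tree encoded by `ω`. -/
def Z (ω : Config) (u : List ℕ) (k : ℕ) : ℕ :=
  Nat.card {v : List ℕ // v.length = k ∧ memTree ω (u ++ v)}

/-- `GW` is the law of the Galton–Watson tree with offspring distribution `q`:
under `GW` the numbers of children attached to the distinct labels
are i.i.d. with distribution `q`. -/
def IsGW (q : ℕ → ℝ) (GW : Measure Config) : Prop :=
  IsProbabilityMeasure GW ∧
    ∀ (S : Finset (List ℕ)) (g : List ℕ → ℕ),
      GW {ω | ∀ u ∈ S, ω u = g u} = ∏ u ∈ S, ENNReal.ofReal (q (g u))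

/-- The probability generating function `φ_n(x) = E[x^{Z_n}]` of the population
at height `n` under the measure `GW`. -/
def pgf (GW : Measure Config) (n : ℕ) (x : ℝ) : ℝ :=
  ∫ ω, x ^ (Z ω [] n) ∂GW

open ProbabilityTheory

def gen (ω : Config) : ℕ → Finset (List ℕ)
  | 0 => {[]}
  | n+1 => (gen ω n).biUnion fun v => (Finset.range (ω v)).image fun i => v ++ [i]

lemma memTree_append_singleton (ω : Config) (v : List ℕ) (i : ℕ) :
    memTree ω (v ++ [i]) ↔ memTree ω v ∧ i < ω v := by
  unfold memTree
  constructor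
  · intro h
    refine ⟨fun k hk => ?_, ?_⟩
    · have := h k (by simp; omega)
      simpa [List.getElem_append, hk, List.take_append_of_le_length hk.le] using this
    · have := h v.length (by simp)
      simpa using this
  · rintro ⟨h1, h2⟩ k hk
    rcases lt_or_ge k v.length with h | h
    · simpa [List.getElem_append, h, List.take_append_of_le_length h.le] using h1 k h
    · have : k = v.length := by simp at hk; omega
      subst this
      simpa using h2

lemma mem_gen (ω : Config) (n : ℕ) (v : List ℕ) :
    v ∈ gen ω n ↔ v.length = n ∧ memTree ω v := by
  induction n generalizing v with
  | zero =>
    simp only [gen, Finset.mem_singleton, List.length_eq_zero_iff]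
    constructor
    · rintro rfl; exact ⟨rfl, by intro k hk; simp at hk⟩
    · exact fun h => h.1
  | succ n ih =>
    simp only [gen, Finset.mem_biUnion, Finset.mem_image, Finset.mem_range]
    constructor
    · rintro ⟨a, ha, i, hi, rfl⟩
      rw [ih] at ha
      exact ⟨by simp [ha.1], (memTree_append_singleton _ _ _).2 ⟨ha.2, hi⟩⟩
    · rintro ⟨h1, h2⟩
      rcases List.eq_nil_or_concat v with rfl | ⟨w, i, rfl⟩
      · simp at h1
      · simp only [List.concat_eq_append] at *
        rw [memTree_append_singleton] at h2
        exact ⟨w, (ih _).2 ⟨by simpa using h1, h2.1⟩, i, h2.2, rfl⟩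

lemma Z_eq (ω : Config) (n : ℕ) : Z ω [] n = (gen ω n).card := by
  unfold Z
  rw [← Nat.card_eq_finsetCard (gen ω n)]
  refine Nat.card_congr (Equiv.subtypeEquivRight fun v => ?_)
  simp [mem_gen]

lemma card_gen_succ (ω : Config) (n : ℕ) : (gen ω (n+1)).card = ∑ v ∈ gen ω n, ω v := by
  rw [gen, Finset.card_biUnion]
  · refine Finset.sum_congr rfl fun v _ => ?_
    rw [Finset.card_image_of_injective _ (fun a b h => by simpa using h), Finset.card_range]
  · intro a _ b _ hab
    rw [Function.onFun, Finset.disjoint_left]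
    intro x hx hy
    simp only [Finset.mem_image] at hx hy
    obtain ⟨i, _, rfl⟩ := hx
    obtain ⟨j, _, h⟩ := hy
    exact hab ((List.append_inj' h rfl).1).symm

lemma iIndep_eval {q : ℕ → ℝ} {GW : Measure Config} (hGW : IsGW q GW) :
    iIndepFun (fun (u : List ℕ) (ω : Config) => ω u) GW := by
  have := hGW.1
  rw [iIndepFun_iff_iIndep]
  refine iIndepSets.iIndep (fun u => (measurable_pi_apply u).comap_le)
    (fun u => {A | ∃ k : ℕ, A = {ω : Config | ω u = k}}) ?_ ?_ ?_
  · rintro u _ ⟨k, rfl⟩ _ ⟨l, rfl⟩ ⟨ω, h1, h2⟩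
    refine ⟨k, ?_⟩
    simp only [mem_ofPred_eq] at h1 h2
    rw [← h1, ← h2, inter_self]
  · intro u
    apply le_antisymm
    · rintro _ ⟨s, _, rfl⟩
      have : (fun ω : Config => ω u) ⁻¹' s = ⋃ k ∈ s, {ω : Config | ω u = k} := by
        ext ω; simp
      rw [this]
      exact MeasurableSet.biUnion (to_countable s) fun k _ =>
        MeasurableSpace.measurableSet_generateFrom ⟨k, rfl⟩
    · apply MeasurableSpace.generateFrom_le
      rintro _ ⟨k, rfl⟩
      exact ⟨{k}, MeasurableSet.singleton k, by ext; simp⟩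
  · rw [iIndepSets_iff]
    intro S f hf
    choose! g hg using hf
    have h1 : (⋂ i ∈ S, f i) = {ω : Config | ∀ u ∈ S, ω u = g u} := by
      ext ω
      simp only [mem_iInter, mem_ofPred_eq]
      refine forall₂_congr fun u hu => ?_
      rw [hg u hu]; rfl
    rw [h1, hGW.2]
    refine Finset.prod_congr rfl fun u hu => ?_
    have := hGW.2 {u} g
    simp only [Finset.mem_singleton, forall_eq, Finset.prod_singleton] at this
    rw [hg u hu, this]

lemma integral_eval {q : ℕ → ℝ} (hq : ∀ k, 0 ≤ q k) {GW : Measure Config} (hGW : IsGW q GW)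
    (u : List ℕ) {x : ℝ} (hx : x ∈ Ioo (0:ℝ) 1) :
    ∫ ω : Config, x ^ (ω u) ∂GW = ∑' k, q k * x ^ k := by
  have := hGW.1
  have hm : Measurable (fun ω : Config => ω u) := measurable_pi_apply u
  have h0 := integral_map (μ := GW) hm.aemeasurable (f := fun k : ℕ => x ^ k)
    (measurable_from_nat.aestronglyMeasurable)
  rw [← h0, integral_countable]
  · refine tsum_congr fun k => ?_
    rw [map_measureReal_apply hm (MeasurableSet.singleton k), smul_eq_mul]
    have := hGW.2 {u} (fun _ => k)
    simp only [Finset.mem_singleton, forall_eq, Finset.prod_singleton] at this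
    congr 1
    change (GW {ω : Config | ω u = k}).toReal = _
    rw [this, ENNReal.toReal_ofReal (hq k)]
  · have := Measure.isProbabilityMeasure_map (μ := GW) hm.aemeasurable
    refine Integrable.of_bound (C := 1) measurable_from_nat.aestronglyMeasurable
      (ae_of_all _ fun k => ?_)
    rw [Real.norm_eq_abs, abs_of_nonneg (pow_nonneg hx.1.le _)]
    exact pow_le_one₀ hx.1.le hx.2.le

lemma measurableSet_gen (n : ℕ) (V : Finset (List ℕ)) :
    MeasurableSet[⨆ u ∈ {u : List ℕ | u.length < n},
      MeasurableSpace.comap (fun ω : Config => ω u) inferInstance] {ω : Config | gen ω n = V} := by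
  have h : {ω : Config | gen ω n = V} = ⋂ v : List ℕ, {ω | v ∈ gen ω n ↔ v ∈ V} := by
    ext ω; simp [Finset.ext_iff]
  rw [h]
  set M : MeasurableSpace Config := ⨆ u ∈ {u : List ℕ | u.length < n},
      MeasurableSpace.comap (fun ω : Config => ω u) inferInstance with hM
  refine MeasurableSet.iInter fun v => ?_
  have key : MeasurableSet[M] {ω : Config | v ∈ gen ω n} := by
    by_cases hv : v.length = n
    · have : {ω : Config | v ∈ gen ω n} = ⋂ k : ℕ, ⋂ h : k < v.length,
          {ω : Config | v.get ⟨k, h⟩ < ω (v.take k)} := by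
        ext ω; simp only [mem_gen, hv, memTree, mem_ofPred_eq, mem_iInter, true_and]
      rw [this]
      refine MeasurableSet.iInter fun k => MeasurableSet.iInter fun hk => ?_
      have hle : MeasurableSpace.comap (fun ω : Config => ω (v.take k)) inferInstance ≤ M :=
        le_iSup₂_of_le (f := fun (u : List ℕ) (_ : u ∈ {u : List ℕ | u.length < n}) =>
          MeasurableSpace.comap (fun ω : Config => ω u) inferInstance) (v.take k)
          (by simp only [mem_ofPred_eq, List.length_take]; omega) le_rfl
      exact hle _ ⟨Ioi (v.get ⟨k, hk⟩), measurableSet_Ioi, rfl⟩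
    · have : {ω : Config | v ∈ gen ω n} = ∅ := by
        ext ω; simp [mem_gen, hv]
      rw [this]; exact MeasurableSet.empty
  by_cases hv : v ∈ V
  · simpa [hv] using key
  · have e : {ω : Config | v ∈ gen ω n ↔ v ∈ V} = {ω : Config | v ∈ gen ω n}ᶜ := by
      ext ω; simp [hv]
    rw [e]; exact key.compl

lemma measurableSet_gen' (n : ℕ) (V : Finset (List ℕ)) :
    MeasurableSet {ω : Config | gen ω n = V} :=
  (iSup₂_le fun u _ => (measurable_pi_apply u).comap_le :
    (⨆ u ∈ {u : List ℕ | u.length < n},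
      MeasurableSpace.comap (fun ω : Config => ω u) inferInstance) ≤
      (inferInstance : MeasurableSpace Config)) _ (measurableSet_gen n V)

lemma integral_prod_eval {q : ℕ → ℝ} (hq : ∀ k, 0 ≤ q k) {GW : Measure Config} (hGW : IsGW q GW)
    (V : Finset (List ℕ)) {x : ℝ} (hx : x ∈ Ioo (0:ℝ) 1) :
    ∫ ω : Config, ∏ v ∈ V, x ^ (ω v) ∂GW = (∑' k, q k * x ^ k) ^ V.card := by
  have h := ((iIndep_eval hGW).precomp (g := fun v : V => (v : List ℕ))
    Subtype.val_injective).integral_fun_prod_comp (f := fun _ k => x ^ k)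
    (fun i => (measurable_pi_apply _).aemeasurable)
    (fun i => measurable_from_nat.aestronglyMeasurable)
  simp only [integral_eval hq hGW _ hx, Finset.prod_const, Finset.card_univ,
    Fintype.card_coe] at h
  rw [← h]
  refine integral_congr_ae (ae_of_all _ fun ω => ?_)
  exact (Finset.prod_coe_sort V (fun v => x ^ ω v)).symm

lemma setIntegral_gen {q : ℕ → ℝ} (hq : ∀ k, 0 ≤ q k) {GW : Measure Config} (hGW : IsGW q GW)
    (n : ℕ) (V : Finset (List ℕ)) {x : ℝ} (hx : x ∈ Ioo (0:ℝ) 1) :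
    ∫ ω in {ω : Config | gen ω n = V}, x ^ (gen ω (n+1)).card ∂GW
      = ∫ ω in {ω : Config | gen ω n = V}, (∑' k, q k * x ^ k) ^ (gen ω n).card ∂GW := by
  have := hGW.1
  have hA := measurableSet_gen' n V
  by_cases hV : ∀ v ∈ V, v.length = n
  · have e1 : ∫ ω in {ω : Config | gen ω n = V}, x ^ (gen ω (n+1)).card ∂GW
      = ∫ ω in {ω : Config | gen ω n = V}, ∏ v ∈ V, x ^ (ω v) ∂GW := by
      refine setIntegral_congr_fun hA fun ω hω => ?_
      simp only [mem_ofPred_eq] at hω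
      simp only [card_gen_succ, hω, Finset.prod_pow_eq_pow_sum]
    have e2 : ∫ ω in {ω : Config | gen ω n = V}, (∑' k, q k * x ^ k) ^ (gen ω n).card ∂GW
      = ∫ ω in {ω : Config | gen ω n = V}, (∑' k, q k * x ^ k) ^ V.card ∂GW := by
      refine setIntegral_congr_fun hA fun ω hω => ?_
      simp only [mem_ofPred_eq] at hω
      simp only [hω]
    rw [e1, e2, setIntegral_const, smul_eq_mul, ← integral_prod_eval hq hGW V hx,
      ← integral_indicator hA]
    have e3 : ∀ ω : Config, ({ω : Config | gen ω n = V}.indicator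
        (fun ω : Config => ∏ v ∈ V, x ^ (ω v)) ω) =
        ({ω : Config | gen ω n = V}.indicator (fun _ => (1:ℝ)) ω) * ∏ v ∈ V, x ^ (ω v) := by
      intro ω; by_cases h : gen ω n = V <;> simp [h]
    simp only [e3]
    have hY : Measurable fun ω : Config => ∏ v ∈ V, x ^ (ω v) := 
      Finset.measurable_prod _ fun v _ => measurable_from_nat.comp (measurable_pi_apply v)
    have hX : Measurable ({ω : Config | gen ω n = V}.indicator (fun _ => (1:ℝ))) :=
      measurable_const.indicator hA
    have hind := indep_iSup_of_disjoint (fun u => (measurable_pi_apply u).comap_le)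
      ((iIndepFun_iff_iIndep _ _ _).1 (iIndep_eval hGW))
      (S := {u : List ℕ | u.length < n}) (T := {u : List ℕ | u.length = n})
      (disjoint_left.2 fun u h1 h2 => by simp only [mem_ofPred_eq] at h1 h2; omega)
    rw [IndepFun.integral_fun_mul_eq_mul_integral ?_ hX.aestronglyMeasurable
      hY.aestronglyMeasurable, integral_indicator_const _ hA]
    · simp
    · rw [IndepFun_iff_Indep]
      refine indep_of_indep_of_le_left (indep_of_indep_of_le_right hind ?_) ?_
      · apply Measurable.comap_le
        refine Finset.measurable_prod _ fun v hv => ?_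
        have hle : MeasurableSpace.comap (fun ω : Config => ω v) inferInstance ≤
          ⨆ u ∈ {u : List ℕ | u.length = n},
            MeasurableSpace.comap (fun ω : Config => ω u) inferInstance :=
          le_iSup₂_of_le (f := fun (u : List ℕ) (_ : u ∈ {u : List ℕ | u.length = n}) =>
            MeasurableSpace.comap (fun ω : Config => ω u) inferInstance) v
            (hV v hv) le_rfl
        have : Measurable[⨆ u ∈ {u : List ℕ | u.length = n},
            MeasurableSpace.comap (fun ω : Config => ω u) inferInstance] (fun ω : Config => ω v) :=
          Measurable.of_comap_le hle
        exact measurable_from_nat.comp this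
      · apply Measurable.comap_le
        exact Measurable.indicator measurable_const (measurableSet_gen n V)
  · have : {ω : Config | gen ω n = V} = ∅ := by
      push Not at hV
      obtain ⟨v, hv, hn⟩ := hV
      ext ω
      simp only [mem_ofPred_eq, mem_empty_iff_false, iff_false]
      rintro rfl
      exact hn ((mem_gen _ _ _).1 hv).1
    rw [this]; simp

lemma measurable_card_gen (n : ℕ) : Measurable fun ω : Config => (gen ω n).card := by
  refine measurable_to_countable' fun k => ?_
  have : (fun ω : Config => (gen ω n).card) ⁻¹' {k} =
      ⋃ V ∈ {V : Finset (List ℕ) | V.card = k}, {ω : Config | gen ω n = V} := by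
    ext ω; simp
  rw [this]
  exact MeasurableSet.biUnion (to_countable _) fun V _ => measurableSet_gen' n V

lemma integrable_gen {GW : Measure Config} [IsProbabilityMeasure GW] (n : ℕ) {x : ℝ}
    (h0 : 0 ≤ x) (h1 : x ≤ 1) : Integrable (fun ω : Config => x ^ (gen ω n).card) GW := by
  refine Integrable.of_bound (C := 1) 
    (measurable_from_nat.comp (measurable_card_gen n)).aestronglyMeasurable
      (ae_of_all _ fun k => ?_)
  rw [Real.norm_eq_abs, abs_of_nonneg (pow_nonneg h0 _)]
  exact pow_le_one₀ h0 h1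

lemma pgf_succ {q : ℕ → ℝ} (hq : ∀ k, 0 ≤ q k) {GW : Measure Config} (hGW : IsGW q GW)
    (n : ℕ) {x : ℝ} (hx : x ∈ Ioo (0:ℝ) 1) (hF : (∑' k, q k * x ^ k) ∈ Ioo (0:ℝ) 1) :
    pgf GW (n+1) x = pgf GW n (∑' k, q k * x ^ k) := by
  have := hGW.1
  unfold pgf
  simp only [Z_eq]
  have hU : (⋃ V : Finset (List ℕ), {ω : Config | gen ω n = V}) = univ := by
    ext ω; simp
  have hd : Pairwise (Function.onFun Disjoint
      fun V : Finset (List ℕ) => {ω : Config | gen ω n = V}) := by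
    intro V W hVW
    exact disjoint_left.2 fun ω h1 h2 => hVW (h1.symm.trans h2)
  have a1 := hasSum_integral_iUnion (μ := GW) (measurableSet_gen' n) hd
    (integrable_gen (n+1) hx.1.le hx.2.le).integrableOn
  have a2 := hasSum_integral_iUnion (μ := GW) (measurableSet_gen' n) hd
    (integrable_gen n hF.1.le hF.2.le).integrableOn
  rw [hU] at a1 a2
  simp only [setIntegral_gen hq hGW n _ hx] at a1
  simpa using a1.unique a2

lemma pgf_zero {GW : Measure Config} [IsProbabilityMeasure GW] (x : ℝ) :
    pgf GW 0 x = x := by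
  unfold pgf
  simp [Z_eq, gen]

section analysis

variable {q : ℕ → ℝ}

lemma exists_two_le (hq : ∀ k, 0 ≤ q k) (hq0 : q 0 = 0) (hs : ∑' k, q k = 1)
    (hm : 1 < ∑' k : ℕ, (k : ℝ) * q k) : ∃ k, 2 ≤ k ∧ 0 < q k := by
  by_contra! h
  have : ∀ k : ℕ, (k : ℝ) * q k = q k := by
    intro k
    rcases Nat.lt_or_ge k 2 with hk | hk
    · interval_cases k <;> simp [hq0]
    · rw [le_antisymm (h k hk) (hq k)]; simp
  simp only [this, hs] at hm
  exact lt_irrefl _ hm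

lemma F_mem (hq : ∀ k, 0 ≤ q k) (hq0 : q 0 = 0) (hs : ∑' k, q k = 1) (sq : Summable q)
    (hex : ∃ k, 2 ≤ k ∧ 0 < q k) {x : ℝ} (hx : x ∈ Ioo (0:ℝ) 1) :
    0 < ∑' k, q k * x ^ k ∧ ∑' k, q k * x ^ k < x := by
  obtain ⟨k, hk, hqk⟩ := hex
  have hnn : ∀ k, 0 ≤ q k * x ^ k := fun k => mul_nonneg (hq k) (pow_nonneg hx.1.le _)
  have hle : ∀ k, q k * x ^ k ≤ q k * x := by
    intro k
    rcases Nat.eq_zero_or_pos k with rfl | h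
    · simp [hq0]
    · exact mul_le_mul_of_nonneg_left (pow_le_of_le_one hx.1.le hx.2.le h.ne') (hq k)
  have s2 : Summable fun k => q k * x := sq.mul_right x
  have s1 : Summable fun k => q k * x ^ k := Summable.of_nonneg_of_le hnn hle s2
  refine ⟨s1.tsum_pos hnn k (mul_pos hqk (pow_pos hx.1 _)), ?_⟩
  have := Summable.tsum_lt_tsum hle (i := k)
    (mul_lt_mul_of_pos_left (pow_lt_self_of_lt_one₀ hx.1 hx.2 (by omega)) hqk) s1 s2
  rwa [tsum_mul_right, hs, one_mul] at this

lemma dF_bound (hq : ∀ k, 0 ≤ q k) (k : ℕ) {x : ℝ} (hx : x ∈ Icc (0:ℝ) 1) :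
    ‖q k * ((k : ℝ) * x ^ (k - 1))‖ ≤ (k : ℝ) * q k := by
  have h1 : x ^ (k-1) ≤ 1 := pow_le_one₀ hx.1 hx.2
  have h0 : 0 ≤ x ^ (k-1) := pow_nonneg hx.1 _
  have hk : (0:ℝ) ≤ (k:ℝ) * q k := mul_nonneg (Nat.cast_nonneg k) (hq k)
  rw [Real.norm_eq_abs, abs_of_nonneg (mul_nonneg (hq k) (mul_nonneg (Nat.cast_nonneg k) h0))]
  nlinarith

lemma F_deriv (hq : ∀ k, 0 ≤ q k) (sq : Summable q) (sk : Summable fun k : ℕ => (k : ℝ) * q k)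
    {x : ℝ} (hx : x ∈ Ioo (0:ℝ) 1) :
    HasDerivAt (fun x => ∑' k, q k * x ^ k) (∑' k : ℕ, q k * ((k : ℝ) * x ^ (k - 1))) x := by
  refine hasDerivAt_tsum_of_isPreconnected sk isOpen_Ioo isPreconnected_Ioo
    (g := fun k x => q k * x ^ k) (g' := fun k x => q k * ((k : ℝ) * x ^ (k - 1)))
    (fun k y _ => (hasDerivAt_pow k y).const_mul _)
    (fun k y hy => dF_bound hq k ⟨hy.1.le, hy.2.le⟩) hx ?_ hx
  refine Summable.of_nonneg_of_le (fun k => mul_nonneg (hq k) (pow_nonneg hx.1.le _))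
    (fun k => ?_) sq
  exact mul_le_of_le_one_right (hq k) (pow_le_one₀ hx.1.le hx.2.le)

lemma dF_pos (hq : ∀ k, 0 ≤ q k) (sk : Summable fun k : ℕ => (k : ℝ) * q k)
    (hex : ∃ k, 2 ≤ k ∧ 0 < q k) {x : ℝ} (hx : x ∈ Ioo (0:ℝ) 1) :
    0 < ∑' k : ℕ, q k * ((k : ℝ) * x ^ (k - 1)) := by
  obtain ⟨k, hk, hqk⟩ := hex
  have s1 : Summable fun k : ℕ => q k * ((k : ℝ) * x ^ (k - 1)) :=
    Summable.of_norm_bounded sk fun k => dF_bound hq k ⟨hx.1.le, hx.2.le⟩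
  refine s1.tsum_pos (fun k => mul_nonneg (hq k)
    (mul_nonneg (Nat.cast_nonneg k) (pow_nonneg hx.1.le _))) k ?_
  have : (0:ℝ) < k := by exact_mod_cast (by omega : 0 < k)
  have := pow_pos hx.1 (k-1)
  positivity

end analysis

/-- For a Galton–Watson process with offspring distribution `q` satisfying `q 0 = 0` and
mean `m ∈ (1, ∞)`, with `φ_n` the probability generating function of the `n`-th generation
and `φinv n` its inverse on `(0,1)`: for every `s ∈ (0,1)`,
`φ'_{n+1}(φ_{n+1}^{-1}(s)) / φ'_n(φ_n^{-1}(s)) → m` as `n → ∞`. -/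
theorem pgf_deriv_ratio_tendsto_mean
    (q : ℕ → ℝ) (hq_nonneg : ∀ ℓ, 0 ≤ q ℓ) (hq_zero : q 0 = 0) (hq_sum : ∑' ℓ, q ℓ = 1)
    (m : ℝ) (hm_def : m = ∑' ℓ : ℕ, (ℓ : ℝ) * q ℓ) (hm_one : 1 < m)
    (GW : Measure Config) (hGW : IsGW q GW)
    (s : ℝ) (hs : s ∈ Set.Ioo (0 : ℝ) 1)
    (φinv : ℕ → ℝ → ℝ)
    (hφinv : ∀ n, ∀ x ∈ Set.Ioo (0 : ℝ) 1,
      φinv n x ∈ Set.Ioo (0 : ℝ) 1 ∧ pgf GW n (φinv n x) = x)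
    (hφinv_left : ∀ n, ∀ y ∈ Set.Ioo (0 : ℝ) 1, φinv n (pgf GW n y) = y) :
    Tendsto
      (fun n => deriv (pgf GW (n + 1)) (φinv (n + 1) s) / deriv (pgf GW n) (φinv n s))
      atTop (nhds m) := by
  have := hGW.1
  have sq : Summable q := by
    by_contra h; rw [tsum_eq_zero_of_not_summable h] at hq_sum; norm_num at hq_sum
  have sk : Summable fun k : ℕ => (k : ℝ) * q k := by
    by_contra h; rw [tsum_eq_zero_of_not_summable h] at hm_def; linarith
  have hex := exists_two_le hq_nonneg hq_zero hq_sum (hm_def ▸ hm_one)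
  set F : ℝ → ℝ := fun x => ∑' k, q k * x ^ k with hFdef
  set F' : ℝ → ℝ := fun x => ∑' k : ℕ, q k * ((k : ℝ) * x ^ (k - 1)) with hF'def
  have hFlt : ∀ x ∈ Ioo (0:ℝ) 1, 0 < F x ∧ F x < x := fun x hx =>
    F_mem hq_nonneg hq_zero hq_sum sq hex hx
  have hFmem : ∀ x ∈ Ioo (0:ℝ) 1, F x ∈ Ioo (0:ℝ) 1 := fun x hx =>
    ⟨(hFlt x hx).1, (hFlt x hx).2.trans hx.2⟩
  have hFd : ∀ x ∈ Ioo (0:ℝ) 1, HasDerivAt F (F' x) x := fun x hx =>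
    F_deriv hq_nonneg sq sk hx
  have hF'pos : ∀ x ∈ Ioo (0:ℝ) 1, 0 < F' x := fun x hx => dF_pos hq_nonneg sk hex hx
  have hF'c : ContinuousOn F' (Icc 0 1) :=
    continuousOn_tsum (fun k => by fun_prop) sk fun k x hx => dF_bound hq_nonneg k hx
  have hsucc : ∀ n, ∀ x ∈ Ioo (0:ℝ) 1, pgf GW (n+1) x = pgf GW n (F x) := fun n x hx =>
    pgf_succ hq_nonneg hGW n hx (hFmem x hx)
  have hcomp : ∀ n, ∀ x ∈ Ioo (0:ℝ) 1, ∀ d, HasDerivAt (pgf GW n) d (F x) →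
      HasDerivAt (pgf GW (n+1)) (d * F' x) x := by
    intro n x hx d hd
    refine (hd.comp x (hFd x hx)).congr_of_eventuallyEq ?_
    filter_upwards [isOpen_Ioo.mem_nhds hx] with y hy
    exact hsucc n y hy
  have hder : ∀ n, ∀ x ∈ Ioo (0:ℝ) 1, ∃ d, 0 < d ∧ HasDerivAt (pgf GW n) d x := by
    intro n
    induction n with
    | zero =>
      intro x _
      have : pgf GW 0 = id := funext fun x => pgf_zero x
      rw [this]
      exact ⟨1, one_pos, hasDerivAt_id x⟩
    | succ n ih =>
      intro x hx
      obtain ⟨d, hd, h⟩ := ih _ (hFmem x hx)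
      exact ⟨_, mul_pos hd (hF'pos x hx), hcomp n x hx d h⟩
  set x : ℕ → ℝ := fun n => φinv n s with hxdef
  have hx : ∀ n, x n ∈ Ioo (0:ℝ) 1 := fun n => (hφinv n s hs).1
  have hxF : ∀ n, F (x (n+1)) = x n := by
    intro n
    have h := hφinv_left n _ (hFmem _ (hx (n+1)))
    rw [← hsucc n _ (hx (n+1)), (hφinv (n+1) s hs).2] at h
    exact h.symm
  have hratio : ∀ n, deriv (pgf GW (n + 1)) (φinv (n + 1) s) / deriv (pgf GW n) (φinv n s)
      = F' (x (n+1)) := by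
    intro n
    obtain ⟨d, hd, h⟩ := hder n _ (hx n)
    have h2 := hcomp n (x (n+1)) (hx (n+1)) d (by rw [hxF]; exact h)
    change deriv (pgf GW (n + 1)) (x (n+1)) / deriv (pgf GW n) (x n) = _
    rw [h.deriv, h2.deriv]
    field_simp
  have hmono : Monotone x := monotone_nat_of_le_succ fun n => by
    have := (hFlt _ (hx (n+1))).2
    rw [hxF] at this
    exact this.le
  have hbdd : BddAbove (range x) := ⟨1, by rintro _ ⟨n, rfl⟩; exact (hx n).2.le⟩
  have hlim := tendsto_atTop_ciSup hmono hbdd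
  set L := ⨆ n, x n
  have hL0 : 0 < L := (hx 0).1.trans_le (le_ciSup hbdd 0)
  have hL1 : L ≤ 1 := ciSup_le fun n => (hx n).2.le
  have hL : L = 1 := by
    by_contra hne
    have hLm : L ∈ Ioo (0:ℝ) 1 := ⟨hL0, lt_of_le_of_ne hL1 hne⟩
    have h1 : Tendsto (fun n => F (x (n+1))) atTop (nhds (F L)) :=
      (hFd L hLm).continuousAt.tendsto.comp (hlim.comp (tendsto_add_atTop_nat 1))
    simp only [hxF] at h1
    exact (hFlt L hLm).2.ne (tendsto_nhds_unique h1 hlim)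
  rw [hL] at hlim
  simp only [hratio]
  have hm : F' 1 = m := by
    rw [hm_def, hF'def]
    exact tsum_congr fun k => by simp [mul_comm]
  rw [← hm]
  refine (hF'c 1 (by simp)).tendsto.comp (tendsto_nhdsWithin_iff.2
    ⟨hlim.comp (tendsto_add_atTop_nat 1), Eventually.of_forall fun n => ?_⟩)
  exact ⟨(hx _).1.le, (hx _).2.le⟩

end
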